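/- arXiv:0706.0287 — 2 statements merged into one kernel-verified Lean document; each statement's English description precedes it below -/
import Mathlib

section
/- In a co-Frobenius quasitriangular Hopf algebra, a_α = b_α; that is, α(R¹)R² = α(S⁻¹(R²))R¹. -/
open TensorProduct Coalgebra HopfAlgebra

variable {k H : Type*} [Field k] [Ring H] [HopfAlgebra k H]

/-- The antipode of `H`, as a linear map. -/
local notation "𝐒" => HopfAlgebra.antipode (R := k)

/-- Convolution product on the dual of `H`: `(conv f g) h = f h₁ * g h₂`. -/
noncomputable def conv (f g : H →ₗ[k] k) : H →ₗ[k] k :=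
  (LinearMap.mul' k k) ∘ₗ (TensorProduct.map f g) ∘ₗ (Coalgebra.comul (R := k))

/-- `h ↦ f h₁ • h₂`. -/
noncomputable def lT (f : H →ₗ[k] k) : H →ₗ[k] H :=
  (TensorProduct.lid k H).toLinearMap ∘ₗ (f.rTensor H) ∘ₗ (Coalgebra.comul (R := k))

/-- The Sweedler sum `h ↦ f h₁ • p h₃ • g h₂`. -/
noncomputable def sw3 (f : H →ₗ[k] k) (g : H →ₗ[k] H) (p : H →ₗ[k] k) : H →ₗ[k] H :=
  (TensorProduct.lid k H).toLinearMap
    ∘ₗ (TensorProduct.rid k (k ⊗[k] H)).toLinearMap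
    ∘ₗ (TensorProduct.map (TensorProduct.map f g) p)
    ∘ₗ ((Coalgebra.comul (R := k)).rTensor H)
    ∘ₗ (Coalgebra.comul (R := k))

/-- `χ(h) = α(h₂) • S⁻²(h₁)`, the generalized Nakayama automorphism. -/
noncomputable def chiMap (Sinv : H →ₗ[k] H) (f : H →ₗ[k] k) : H →ₗ[k] H :=
  (TensorProduct.rid k H).toLinearMap
    ∘ₗ (TensorProduct.map (Sinv ∘ₗ Sinv) f)
    ∘ₗ (Coalgebra.comul (R := k))

/-- `f(R¹) • R²` for `R = R¹ ⊗ R² ∈ H ⊗ H`. -/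
noncomputable def lap (f : H →ₗ[k] k) : (H ⊗[k] H) →ₗ[k] H :=
  (TensorProduct.lid k H).toLinearMap ∘ₗ (f.rTensor H)

/-- `f(R²) • R¹` for `R = R¹ ⊗ R² ∈ H ⊗ H`. -/
noncomputable def rap (f : H →ₗ[k] k) : (H ⊗[k] H) →ₗ[k] H :=
  (TensorProduct.rid k H).toLinearMap ∘ₗ (LinearMap.lTensor H f)

/-- The Drinfeld element `u = S(R²)R¹`. -/
noncomputable def uElt (Rm : H ⊗[k] H) : H :=
  (LinearMap.mul' k H)
    ((TensorProduct.comm k H H)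
      ((LinearMap.lTensor H (HopfAlgebra.antipode (R := k))) Rm))

/-- Convolution product on the dual of `H ⊗ H`. -/
noncomputable def conv2 (f g : (H ⊗[k] H) →ₗ[k] k) : (H ⊗[k] H) →ₗ[k] k :=
  (LinearMap.mul' k k) ∘ₗ (TensorProduct.map f g) ∘ₗ (Coalgebra.comul (R := k) (A := H ⊗[k] H))

/-- `(h ⊗ l) ↦ σ(h₂ ⊗ l₂) • (l₁ * h₁)`. -/
noncomputable def ac1 (σ : (H ⊗[k] H) →ₗ[k] k) : (H ⊗[k] H) →ₗ[k] H :=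
  (TensorProduct.rid k H).toLinearMap
    ∘ₗ (TensorProduct.map ((LinearMap.mul' k H) ∘ₗ (TensorProduct.comm k H H).toLinearMap) σ)
    ∘ₗ (TensorProduct.tensorTensorTensorComm k H H H H).toLinearMap
    ∘ₗ (TensorProduct.map (Coalgebra.comul (R := k)) (Coalgebra.comul (R := k)))

/-- `(h ⊗ l) ↦ σ(h₁ ⊗ l₁) • (h₂ * l₂)`. -/
noncomputable def ac2 (σ : (H ⊗[k] H) →ₗ[k] k) : (H ⊗[k] H) →ₗ[k] H :=
  (TensorProduct.lid k H).toLinearMap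
    ∘ₗ (TensorProduct.map σ (LinearMap.mul' k H))
    ∘ₗ (TensorProduct.tensorTensorTensorComm k H H H H).toLinearMap
    ∘ₗ (TensorProduct.map (Coalgebra.comul (R := k)) (Coalgebra.comul (R := k)))

/-- `(h ⊗ l) ↦ ρ(h₁ ⊗ l₁) * lam(h₂ * l₂) * τ(h₃ ⊗ l₃)`. -/
noncomputable def trip (lam : H →ₗ[k] k) (ρ τ : (H ⊗[k] H) →ₗ[k] k) : (H ⊗[k] H) →ₗ[k] k :=
  (LinearMap.mul' k k)
    ∘ₗ ((LinearMap.mul' k k).rTensor k)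
    ∘ₗ (TensorProduct.map (TensorProduct.map ρ (lam ∘ₗ (LinearMap.mul' k H))) τ)
    ∘ₗ ((TensorProduct.tensorTensorTensorComm k H H H H).toLinearMap.rTensor (H ⊗[k] H))
    ∘ₗ (TensorProduct.tensorTensorTensorComm k (H ⊗[k] H) H (H ⊗[k] H) H).toLinearMap
    ∘ₗ (TensorProduct.map
          (((Coalgebra.comul (R := k)).rTensor H) ∘ₗ (Coalgebra.comul (R := k)))
          (((Coalgebra.comul (R := k)).rTensor H) ∘ₗ (Coalgebra.comul (R := k))))

/-- `u(h) = σ(h₂ ⊗ S h₁)`. -/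
noncomputable def uF (σ : (H ⊗[k] H) →ₗ[k] k) : H →ₗ[k] k :=
  σ ∘ₗ (TensorProduct.comm k H H).toLinearMap
    ∘ₗ ((HopfAlgebra.antipode (R := k)).rTensor H) ∘ₗ (Coalgebra.comul (R := k))

/-- `v(h) = σ(h₁ ⊗ S h₂)`. -/
noncomputable def vF (σ : (H ⊗[k] H) →ₗ[k] k) : H →ₗ[k] k :=
  σ ∘ₗ (LinearMap.lTensor H (HopfAlgebra.antipode (R := k))) ∘ₗ (Coalgebra.comul (R := k))

/-- `u⁻¹(h) = σ(S²(h₂) ⊗ h₁)`. -/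
noncomputable def uinvF (σ : (H ⊗[k] H) →ₗ[k] k) : H →ₗ[k] k :=
  σ ∘ₗ (((HopfAlgebra.antipode (R := k)) ∘ₗ (HopfAlgebra.antipode (R := k))).rTensor H)
    ∘ₗ (TensorProduct.comm k H H).toLinearMap ∘ₗ (Coalgebra.comul (R := k))

/-- `v⁻¹(h) = σ(S²(h₁) ⊗ h₂)`. -/
noncomputable def vinvF (σ : (H ⊗[k] H) →ₗ[k] k) : H →ₗ[k] k :=
  σ ∘ₗ (((HopfAlgebra.antipode (R := k)) ∘ₗ (HopfAlgebra.antipode (R := k))).rTensor H)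
    ∘ₗ (Coalgebra.comul (R := k))

theorem rap_algHom (α : H →ₐ[k] k) (t : H ⊗[k] H) :
    rap α.toLinearMap t =
      (Algebra.TensorProduct.rid k k H).toAlgHom.comp
        (Algebra.TensorProduct.map (AlgHom.id k H) α) t := by
  induction t using TensorProduct.induction_on with
  | zero => simp
  | tmul x y => simp [rap]
  | add x y hx hy => rw [map_add, map_add, hx, hy]

theorem rap_mul (α : H →ₐ[k] k) (s t : H ⊗[k] H) :
    rap α.toLinearMap (s * t) = rap α.toLinearMap s * rap α.toLinearMap t := by
  simp only [rap_algHom, map_mul]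

theorem rap_one (α : H →ₐ[k] k) : rap α.toLinearMap (1 : H ⊗[k] H) = 1 := by
  simp only [rap_algHom, map_one]

theorem rap_comm (f : H →ₗ[k] k) (t : H ⊗[k] H) :
    rap f (TensorProduct.comm k H H t) = lap f t := by
  induction t using TensorProduct.induction_on with
  | zero => simp
  | tmul x y => simp [rap, lap]
  | add x y hx hy => simp only [map_add, hx, hy]

theorem lap_mul (α : H →ₐ[k] k) (s t : H ⊗[k] H) :
    lap α.toLinearMap (s * t) = lap α.toLinearMap s * lap α.toLinearMap t := by
  have h : TensorProduct.comm k H H (s * t) =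
      TensorProduct.comm k H H s * TensorProduct.comm k H H t :=
    map_mul (Algebra.TensorProduct.comm k H H) s t
  rw [← rap_comm, h, rap_mul, rap_comm, rap_comm]

theorem lap_one (α : H →ₐ[k] k) : lap α.toLinearMap (1 : H ⊗[k] H) = 1 := by
  simp [lap, Algebra.TensorProduct.one_def]

theorem apply_lap (f g : H →ₗ[k] k) (t : H ⊗[k] H) : g (lap f t) = f (rap g t) := by
  induction t using TensorProduct.induction_on with
  | zero => simp
  | tmul x y => simp [rap, lap, mul_comm]
  | add x y hx hy => simp only [map_add, hx, hy]

/-- The inverse of the antipode satisfies `h₂ S⁻¹(h₁) = ε(h)`. -/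
theorem mul_comm_rTensor_antipode_inv {Sinv : H →ₗ[k] H} (hl : ∀ h : H, Sinv (𝐒 h) = h)
    (hr : ∀ h : H, 𝐒 (Sinv h) = h) (h : H) :
    LinearMap.mul' k H (TensorProduct.comm k H H (Sinv.rTensor H (comul (R := k) h))) =
      algebraMap k H (counit h) := by
  have inj : Function.Injective (antipode k (A := H)) := Function.LeftInverse.injective hl
  apply inj
  rw [Algebra.algebraMap_eq_smul_one, map_smul, antipode_one, ← Algebra.algebraMap_eq_smul_one,
    ← sum_mul_antipode_eq_algebraMap_counit (ℛ k h), ← (ℛ k h).eq]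
  simp [map_sum, antipode_mul_antidistrib, hr]

theorem conv_eq_sum (f g : H →ₗ[k] k) {x : H} {ι : Type*} (r : Repr k x ι) :
    conv f g x = ∑ i ∈ r.index, f (r.left i) * g (r.right i) := by
  simp [conv, ← r.eq]

/-- `x₁ λ(x₂ h) = λ(x h₂) S⁻¹(h₁)` for a left integral `λ`, tested against a functional `f`. -/
theorem integral_lT_mul {lam : H →ₗ[k] k} (hint : ∀ f : H →ₗ[k] k, conv f lam = f 1 • lam)
    {Sinv : H →ₗ[k] H} (hl : ∀ h : H, Sinv (𝐒 h) = h) (hr : ∀ h : H, 𝐒 (Sinv h) = h)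
    (f : H →ₗ[k] k) (x h : H) :
    lam (lT f x * h) =
      ∑ i ∈ (ℛ k h).index, f (Sinv ((ℛ k h).left i)) * lam (x * (ℛ k h).right i) := by
  have key : ∀ i, f (Sinv ((ℛ k h).left i)) * lam (x * (ℛ k h).right i) =
      ∑ j ∈ (ℛ k x).index, ∑ l ∈ (ℛ k ((ℛ k h).right i)).index,
        f ((ℛ k x).left j * ((ℛ k ((ℛ k h).right i)).left l * Sinv ((ℛ k h).left i))) *
        lam ((ℛ k x).right j * (ℛ k ((ℛ k h).right i)).right l) := by
    intro i
    have := LinearMap.congr_fun (hint (f ∘ₗ LinearMap.mulRight k (Sinv ((ℛ k h).left i))))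
      (x * (ℛ k h).right i)
    rw [conv_eq_sum _ _ ((ℛ k x).mul (ℛ k ((ℛ k h).right i)))] at this
    simp [Finset.sum_product, mul_assoc] at this
    exact this.symm
  rw [Finset.sum_congr rfl fun i _ => key i, Finset.sum_comm]
  have hx : lT f x = ∑ j ∈ (ℛ k x).index, f ((ℛ k x).left j) • (ℛ k x).right j := by
    conv_lhs => rw [lT, LinearMap.comp_apply, LinearMap.comp_apply, ← (ℛ k x).eq]
    simp
  rw [hx, Finset.sum_mul, map_sum]
  refine Finset.sum_congr rfl fun j _ => ?_
  let G : H ⊗[k] H →ₗ[k] H :=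
    LinearMap.mul' k H ∘ₗ (TensorProduct.comm k H H).toLinearMap ∘ₗ Sinv.rTensor H
  let F : H ⊗[k] (H ⊗[k] H) →ₗ[k] k :=
    LinearMap.mul' k k ∘ₗ TensorProduct.map
      (f ∘ₗ LinearMap.mulLeft k ((ℛ k x).left j) ∘ₗ G)
      (lam ∘ₗ LinearMap.mulLeft k ((ℛ k x).right j)) ∘ₗ
      (TensorProduct.assoc k H H H).symm.toLinearMap
  have hF := congrArg F (Coalgebra.sum_tmul_tmul_eq (ℛ k h)
    (fun i => ℛ k ((ℛ k h).left i)) (fun i => ℛ k ((ℛ k h).right i)))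
  have hG : ∀ y : H, ∑ l ∈ (ℛ k y).index, (ℛ k y).right l * Sinv ((ℛ k y).left l) =
      algebraMap k H (counit y) := by
    intro y
    rw [← mul_comm_rTensor_antipode_inv hl hr y]
    conv_rhs => rw [← (ℛ k y).eq]
    simp
  simp only [F, G, map_sum, LinearMap.comp_apply, LinearEquiv.coe_coe,
    TensorProduct.assoc_symm_tmul, TensorProduct.map_tmul, LinearMap.rTensor_tmul,
    TensorProduct.comm_tmul, LinearMap.mul'_apply, LinearMap.mulLeft_apply] at hF
  rw [← hF]
  simp_rw [← Finset.sum_mul, ← map_sum, ← Finset.mul_sum, hG]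
  have hε := congrArg (LinearMap.mulLeft k ((ℛ k x).right j)) (Coalgebra.sum_counit_smul (ℛ k h))
  have hε' := congrArg lam hε
  simp only [LinearMap.mulLeft_apply, map_sum, map_smul, smul_eq_mul] at hε'
  simp only [Algebra.algebraMap_eq_smul_one, mul_smul_comm, mul_one, map_smul, smul_eq_mul,
    smul_mul_assoc]
  rw [← hε', Finset.mul_sum]
  exact Finset.sum_congr rfl fun i _ => by ring

/-- A nonzero left integral has trivial left kernel. -/
theorem eq_zero_of_integral_mul_eq_zero {lam : H →ₗ[k] k} (hne : lam ≠ 0)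
    (hint : ∀ f : H →ₗ[k] k, conv f lam = f 1 • lam)
    {Sinv : H →ₗ[k] H} (hl : ∀ h : H, Sinv (𝐒 h) = h) (hr : ∀ h : H, 𝐒 (Sinv h) = h)
    {x : H} (hx : ∀ h : H, lam (x * h) = 0) : x = 0 := by
  have stable : ∀ (f : H →ₗ[k] k) (y : H), (∀ h, lam (y * h) = 0) →
      ∀ h, lam (lT f y * h) = 0 := by
    intro f y hy h
    simp [integral_lT_mul hint hl hr, hy]
  have counit_zero : ∀ y : H, (∀ h, lam (y * h) = 0) → counit (R := k) y = 0 := by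
    intro y hy
    let b := Module.Basis.ofVectorSpace k H
    obtain ⟨c, hc⟩ := TensorProduct.eq_repr_basis_left b (comul (R := k) y)
    have hcoord : ∀ i h, lam (c i * h) = 0 := by
      intro i h
      have hci : lT (b.coord i) y = c i := by
        classical
        rw [lT, LinearMap.comp_apply, LinearMap.comp_apply, ← hc]
        simp only [Finsupp.sum, map_sum, LinearMap.rTensor_tmul, Module.Basis.coord_apply,
          Module.Basis.repr_self, Finsupp.single_apply, LinearEquiv.coe_coe,
          TensorProduct.lid_tmul, ite_smul, one_smul, zero_smul, Finset.sum_ite_eq',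
          Finsupp.mem_support_iff]
        exact ite_eq_left_iff.mpr fun h0 => (not_not.mp h0).symm
      rw [← hci]
      exact stable _ y hy h
    obtain ⟨p, hp⟩ : ∃ p, lam p ≠ 0 := by
      by_contra! hcon
      exact hne (LinearMap.ext hcon)
    have e := mul_comm_rTensor_antipode_inv hl hr y
    rw [← hc] at e
    have e' := congrArg (fun z => lam (z * p)) e
    simp [Finsupp.sum, Finset.sum_mul, mul_assoc, hcoord, Algebra.algebraMap_eq_smul_one] at e'
    tauto
  rw [← Module.forall_dual_apply_eq_zero_iff k]
  intro f
  have h0 := counit_zero _ (stable f x hx)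
  have h1 : counit (R := k) (lT f x) = f x := by
    change counit (R := k) (lap f (comul x)) = f x
    rw [apply_lap]
    simp [rap]
  rw [← h1, h0]

theorem rap_lTensor_mul (f g : H →ₗ[k] k) (s t : H ⊗[k] H) :
    TensorProduct.rid k H ((LinearMap.mul' k k ∘ₗ TensorProduct.map g f).lTensor H
      (LinearMap.lTensor H
          ((Algebra.TensorProduct.includeRight : H →ₐ[k] (H ⊗[k] H))).toLinearMap s *
        LinearMap.lTensor H
          ((Algebra.TensorProduct.includeLeft : H →ₐ[k] (H ⊗[k] H))).toLinearMap t)) =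
      rap f s * rap g t := by
  induction s using TensorProduct.induction_on with
  | zero => simp
  | add x y hx hy => simp only [map_add, add_mul, hx, hy]
  | tmul p q =>
    induction t using TensorProduct.induction_on with
    | zero => simp
    | add x y hx hy => simp only [map_add, mul_add, hx, hy]
    | tmul p' q' => simp [rap, smul_smul]

/-- `b_α` is inverse to `α(R²) R¹`. -/
theorem rap_mul_rap_antipode_inv {Sinv : H →ₗ[k] H} (hl : ∀ h : H, Sinv (𝐒 h) = h)
    (hr : ∀ h : H, 𝐒 (Sinv h) = h) (α : H →ₐ[k] k) {R : H ⊗[k] H}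
    (hqt2 : (Coalgebra.comul (R := k)).lTensor H R =
      (LinearMap.lTensor H ((Algebra.TensorProduct.includeRight : H →ₐ[k] (H ⊗[k] H))).toLinearMap R) *
      (LinearMap.lTensor H ((Algebra.TensorProduct.includeLeft : H →ₐ[k] (H ⊗[k] H))).toLinearMap R))
    (hqt3r : rap (Coalgebra.counit (R := k)) R = 1) :
    rap α.toLinearMap R * rap (α.toLinearMap ∘ₗ Sinv) R = 1 := by
  have hconv : (LinearMap.mul' k k ∘ₗ TensorProduct.map (α.toLinearMap ∘ₗ Sinv) α.toLinearMap) ∘ₗ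
      comul (R := k) = counit := by
    ext h
    have e := congrArg α (mul_comm_rTensor_antipode_inv hl hr h)
    rw [AlgHom.commutes, Algebra.algebraMap_self, RingHom.id_apply] at e
    rw [← e, LinearMap.comp_apply, ← (ℛ k h).eq]
    simp [mul_comm]
  rw [← rap_lTensor_mul, ← hqt2, ← LinearMap.lTensor_comp_apply, hconv, ← hqt3r]
  rfl

/-- In a co-Frobenius quasitriangular Hopf algebra, $a_α = b_α$:
$α(R^1)R^2 = α(S^{-1}(R^2))R^1$. -/
theorem a_alpha_eq_b_alpha
    (lam : H →ₗ[k] k) (hlam_ne : lam ≠ 0)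
    (hlam_int : ∀ f : H →ₗ[k] k, conv f lam = f 1 • lam)
    (a : H) (ha_ne : a ≠ 0) (ha_grp : Coalgebra.comul (R := k) a = a ⊗ₜ[k] a)
    (ha_mod : ∀ h : H, lT lam h = lam h • (𝐒 a))
    (ha_S2 : ∀ h : H, lam (𝐒 (𝐒 h)) = lam (a * h * 𝐒 a))
    (Sinv : H →ₗ[k] H) (hSinv_l : ∀ h : H, Sinv (𝐒 h) = h)
    (hSinv_r : ∀ h : H, 𝐒 (Sinv h) = h)
    (α : H →ₐ[k] k)
    (hα : ∀ h l : H, lam (l * h) = lam ((chiMap Sinv α.toLinearMap h) * l))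
    (R U : H ⊗[k] H) (hRU : R * U = 1) (hUR : U * R = 1)
    (hqt4 : ∀ h : H, (TensorProduct.comm k H H) (Coalgebra.comul (R := k) h) =
      R * (Coalgebra.comul (R := k) h) * U)
    (hqt1 : (Coalgebra.comul (R := k)).rTensor H R =
      (((Algebra.TensorProduct.includeLeft : H →ₐ[k] (H ⊗[k] H))).toLinearMap.rTensor H R) *
      (((Algebra.TensorProduct.includeRight : H →ₐ[k] (H ⊗[k] H))).toLinearMap.rTensor H R))
    (hqt2 : (Coalgebra.comul (R := k)).lTensor H R =
      (LinearMap.lTensor H ((Algebra.TensorProduct.includeRight : H →ₐ[k] (H ⊗[k] H))).toLinearMap R) *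
      (LinearMap.lTensor H ((Algebra.TensorProduct.includeLeft : H →ₐ[k] (H ⊗[k] H))).toLinearMap R))
    (hqt3l : lap (Coalgebra.counit (R := k)) R = 1)
    (hqt3r : rap (Coalgebra.counit (R := k)) R = 1)
    (u' : H) (hu_r : uElt R * u' = 1) (hu_l : u' * uElt R = 1)
    (hS2u : ∀ h : H, 𝐒 (𝐒 h) = uElt R * h * u')
    (hΔu : Coalgebra.comul (R := k) (uElt R) =
      ((uElt R) ⊗ₜ[k] (uElt R)) * (U * ((TensorProduct.comm k H H) U))) :
    lap α.toLinearMap R = rap (α.toLinearMap ∘ₗ Sinv) R := by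
  have nondeg := fun x => eq_zero_of_integral_mul_eq_zero (x := x) hlam_ne hlam_int hSinv_l hSinv_r
  have hag : IsGroupLikeElem k a := by
    refine ⟨?_, ha_grp⟩
    have e := rTensor_counit_comul (R := k) a
    rw [ha_grp, LinearMap.rTensor_tmul] at e
    have e' := congrArg (TensorProduct.lid k H) e
    simp only [TensorProduct.lid_tmul, one_smul] at e'
    exact smul_left_injective k ha_ne (by simpa using e')
  set u := uElt R with hu
  have hua : u * a = a * u := by
    have e := hS2u a
    rw [hag.antipode_antipode] at e
    conv_rhs => rw [e]
    simp [mul_assoc, hu_l]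
  have hSS : ∀ h, Sinv (Sinv h) = u' * h * u := by
    intro h
    have e : h = 𝐒 (𝐒 (u' * h * u)) := by
      rw [hS2u]
      calc h = (u * u') * h * (u * u') := by rw [hu_r]; simp
        _ = _ := by simp only [mul_assoc]
    conv_lhs => rw [e]
    rw [hSinv_l, hSinv_l]
  have hchi : ∀ h, chiMap Sinv α.toLinearMap h = u' * rap α.toLinearMap (comul h) * u := by
    intro h
    rw [← hSS]
    conv_lhs => rw [chiMap, LinearMap.comp_apply, LinearMap.comp_apply]
    generalize comul (R := k) h = t
    induction t using TensorProduct.induction_on with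
    | zero => simp
    | tmul x y => simp [rap]
    | add x y hx hy => simp only [map_add, hx, hy]
  have hcomm : chiMap Sinv α.toLinearMap a * u = chiMap Sinv α.toLinearMap u * a := by
    rw [← sub_eq_zero]
    refine nondeg _ fun l => ?_
    have e := hS2u (l * a * u)
    have e2 := ha_S2 (l * a * u)
    rw [e] at e2
    have r1 : u * (l * a * u) * u' = u * l * a := by
      simp only [mul_assoc, hu_r, mul_one]
    have r2 : a * (l * a * u) * 𝐒 a = a * l * u := by
      rw [mul_assoc l a u, ← hua]
      simp only [mul_assoc, hag.mul_antipode_cancel, mul_one]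
    rw [r1, r2, hα, hα u] at e2
    rw [sub_mul, map_sub, mul_assoc, mul_assoc, e2, sub_self]
  have hinv := rap_mul_rap_antipode_inv hSinv_l hSinv_r α hqt2 hqt3r
  have hUR' : rap α.toLinearMap U * rap α.toLinearMap R = 1 := by rw [← rap_mul, hUR, rap_one]
  have hb : rap (α.toLinearMap ∘ₗ Sinv) R = rap α.toLinearMap U :=
    (left_inv_eq_right_inv hUR' hinv).symm
  have hUl : lap α.toLinearMap U * lap α.toLinearMap R = 1 := by rw [← lap_mul, hUR, lap_one]
  have hscal : α a • (1 : H) = α u • (rap α.toLinearMap U * lap α.toLinearMap U) := by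
    have ra : ∀ x y : H, rap α.toLinearMap (x ⊗ₜ[k] y) = α y • x := by simp [rap]
    rw [hchi, hchi, ha_grp, hΔu, rap_mul, rap_mul, rap_comm, ra, ra] at hcomm
    generalize rap α.toLinearMap U * lap α.toLinearMap U = P at hcomm ⊢
    have l1 : u' * (α a • a) * u * u = α a • (a * u) := by
      simp only [smul_mul_assoc, mul_smul_comm]
      rw [mul_assoc u' a u, ← hua, ← mul_assoc u' u a, hu_l, one_mul, hua]
    have l2 : u' * (α u • u * P) * u * a = α u • (P * (a * u)) := by
      simp only [smul_mul_assoc, mul_smul_comm]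
      rw [← mul_assoc u' u P, hu_l, one_mul, mul_assoc, hua]
    have hcancel : a * u * (u' * 𝐒 a) = 1 := by
      rw [mul_assoc, ← mul_assoc u, hu_r, one_mul, hag.mul_antipode_cancel]
    rw [l1, l2] at hcomm
    have e := congrArg (· * (u' * 𝐒 a)) hcomm
    simpa only [smul_mul_assoc, mul_assoc P, hcancel, mul_one] using e
  have hprop : α a • lap α.toLinearMap R = α u • rap α.toLinearMap U := by
    have e := congrArg (· * lap α.toLinearMap R) hscal
    simpa only [smul_mul_assoc, one_mul, mul_assoc, hUl, mul_one] using e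
  have hcl : counit (R := k) (lap α.toLinearMap R) = 1 := by
    rw [apply_lap, hqt3r]
    exact map_one α
  have hcr : counit (R := k) (rap α.toLinearMap U) = 1 := by
    have hU : lap (counit (R := k)) U = 1 := by
      have e := lap_mul (Bialgebra.counitAlgHom k H) U R
      rw [hUR, lap_one] at e
      change 1 = lap (counit (R := k)) U * lap (counit (R := k)) R at e
      rw [hqt3l, mul_one] at e
      exact e.symm
    rw [← apply_lap, hU]
    exact map_one α
  have hαau : α a = α u := by
    simpa [hcl, hcr] using congrArg (counit (R := k)) hprop
  have hαu : α u ≠ 0 := by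
    intro h0
    have e := congrArg α hu_r
    rw [map_mul, h0, zero_mul, map_one] at e
    exact zero_ne_one e
  rw [hb]
  exact smul_right_injective H hαu (by simpa only [hαau] using hprop)
end

section
/- S(u) = u if and only if a_α = a⁻¹, i.e. if and only if α(R¹)R² = a⁻¹. -/
open TensorProduct Coalgebra HopfAlgebra

variable {k H : Type*} [Field k] [Ring H] [HopfAlgebra k H]

/-- The antipode of `H`, as a linear map. -/
local notation "𝐒" => HopfAlgebra.antipode (R := k)

section InverseAntipode

variable {T : H →ₗ[k] H}

lemma inverse_antipode_mul_comul (hl : ∀ h : H, T (𝐒 h) = h) (hr : ∀ h : H, 𝐒 (T h) = h) (x : H) :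
    LinearMap.mul' k H (T.rTensor H (TensorProduct.comm k H H (comul (R := k) x))) =
      algebraMap k H (counit x) := by
  have key : ∀ z : H ⊗[k] H, 𝐒 (LinearMap.mul' k H (T.rTensor H (TensorProduct.comm k H H z))) =
      LinearMap.mul' k H ((𝐒 : H →ₗ[k] H).rTensor H z) := by
    intro z
    induction z with
    | zero => simp
    | add y z hy hz => simp only [map_add, hy, hz]
    | tmul p q => simp [antipode_mul_antidistrib, hr]
  apply Function.LeftInverse.injective hl
  rw [key, mul_antipode_rTensor_comul_apply]
  simp [Algebra.algebraMap_eq_smul_one]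

lemma mul_inverse_antipode_comul (hl : ∀ h : H, T (𝐒 h) = h) (hr : ∀ h : H, 𝐒 (T h) = h) (x : H) :
    LinearMap.mul' k H (T.lTensor H (TensorProduct.comm k H H (comul (R := k) x))) =
      algebraMap k H (counit x) := by
  have key : ∀ z : H ⊗[k] H, 𝐒 (LinearMap.mul' k H (T.lTensor H (TensorProduct.comm k H H z))) =
      LinearMap.mul' k H ((𝐒 : H →ₗ[k] H).lTensor H z) := by
    intro z
    induction z with
    | zero => simp
    | add y z hy hz => simp only [map_add, hy, hz]
    | tmul p q => simp [antipode_mul_antidistrib, hr]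
  apply Function.LeftInverse.injective hl
  rw [key, mul_antipode_lTensor_comul_apply]
  simp [Algebra.algebraMap_eq_smul_one]

/-- `x ⊗ 1 = (1 ⊗ S⁻¹(x₂)) Δ(x₁)`. -/
lemma sum_one_tmul_mul_comul (hl : ∀ h : H, T (𝐒 h) = h) (hr : ∀ h : H, 𝐒 (T h) = h) {x : H}
    {ι : Type*} (ρ : Coalgebra.Repr k x ι) :
    ∑ i ∈ ρ.index, ((1 : H) ⊗ₜ[k] T (ρ.right i)) * comul (R := k) (ρ.left i) = x ⊗ₜ[k] 1 := by
  have key : ∀ (z : H ⊗[k] H) (q : H), ((1 : H) ⊗ₜ[k] T q) * z =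
      (LinearMap.mul' k H ∘ₗ T.rTensor H ∘ₗ (TensorProduct.comm k H H).toLinearMap).lTensor H
        (TensorProduct.assoc k H H H (z ⊗ₜ q)) := by
    intro z q
    induction z with
    | zero => simp
    | add y z hy hz => simp only [map_add, hy, hz, mul_add, TensorProduct.add_tmul]
    | tmul p r => simp
  calc _ = (LinearMap.mul' k H ∘ₗ T.rTensor H ∘ₗ (TensorProduct.comm k H H).toLinearMap).lTensor H
        (TensorProduct.assoc k H H H ((comul (R := k)).rTensor H (comul x))) := by
        simp_rw [key, ← ρ.eq, map_sum, LinearMap.rTensor_tmul]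
    _ = (Algebra.linearMap k H).lTensor H (counit.lTensor H (comul x)) := by
        rw [coassoc_apply, ← LinearMap.lTensor_comp_apply, ← LinearMap.lTensor_comp_apply]
        congr 2
        ext y
        simpa using inverse_antipode_mul_comul hl hr y
    _ = x ⊗ₜ 1 := by simp

/-- `1 ⊗ x = Δ(x₂) (S⁻¹(x₁) ⊗ 1)`. -/
lemma sum_comul_mul_tmul_one (hl : ∀ h : H, T (𝐒 h) = h) (hr : ∀ h : H, 𝐒 (T h) = h) {x : H}
    {ι : Type*} (ρ : Coalgebra.Repr k x ι) :
    ∑ i ∈ ρ.index, comul (R := k) (ρ.right i) * (T (ρ.left i) ⊗ₜ[k] (1 : H)) = 1 ⊗ₜ[k] x := by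
  have key : ∀ (z : H ⊗[k] H) (q : H), z * (T q ⊗ₜ[k] (1 : H)) =
      (LinearMap.mul' k H ∘ₗ T.lTensor H ∘ₗ (TensorProduct.comm k H H).toLinearMap).rTensor H
        ((TensorProduct.assoc k H H H).symm (q ⊗ₜ z)) := by
    intro z q
    induction z with
    | zero => simp
    | add y z hy hz => simp only [map_add, hy, hz, add_mul, TensorProduct.tmul_add]
    | tmul p r => simp
  calc _ = (LinearMap.mul' k H ∘ₗ T.lTensor H ∘ₗ (TensorProduct.comm k H H).toLinearMap).rTensor H
        ((TensorProduct.assoc k H H H).symm ((comul (R := k)).lTensor H (comul x))) := by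
        simp_rw [key, ← ρ.eq, map_sum, LinearMap.lTensor_tmul]
    _ = (Algebra.linearMap k H).rTensor H (counit.rTensor H (comul x)) := by
        rw [coassoc_symm_apply, ← LinearMap.rTensor_comp_apply, ← LinearMap.rTensor_comp_apply]
        congr 2
        ext y
        simpa using mul_inverse_antipode_comul hl hr y
    _ = 1 ⊗ₜ x := by simp

end InverseAntipode

section Slices

@[simp]
lemma lap_tmul (f : H →ₗ[k] k) (x y : H) : lap f (x ⊗ₜ[k] y) = f x • y := by
  simp [lap]

@[simp]
lemma rap_tmul (f : H →ₗ[k] k) (x y : H) : rap f (x ⊗ₜ[k] y) = f y • x := by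
  simp [rap]

lemma lap_one_tmul_mul (f : H →ₗ[k] k) (y : H) (z : H ⊗[k] H) :
    lap f ((1 ⊗ₜ[k] y) * z) = y * lap f z := by
  induction z with
  | zero => simp
  | add z w hz hw => simp only [map_add, mul_add, hz, hw]
  | tmul p q => simp

lemma rap_mul_tmul_one (f : H →ₗ[k] k) (y : H) (z : H ⊗[k] H) :
    rap f (z * (y ⊗ₜ[k] 1)) = rap f z * y := by
  induction z with
  | zero => simp
  | add z w hz hw => simp only [map_add, add_mul, hz, hw]
  | tmul p q => simp

lemma lap_comm_mul_tmul (f : H →ₗ[k] k) (x y : H) (z : H ⊗[k] H) :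
    lap f (TensorProduct.comm k H H z * (x ⊗ₜ[k] y)) = rap f (z * (1 ⊗ₜ[k] x)) * y := by
  induction z with
  | zero => simp
  | add z w hz hw => simp only [map_add, add_mul, hz, hw]
  | tmul p q => simp

/-- Slices of a tensor by a left integral determine all its slices. -/
lemma lap_eq_of_forall_lap_mul {lam : H →ₗ[k] k}
    (hdense : ∀ (f : H →ₗ[k] k) (s : Finset H), ∃ h : H, ∀ x ∈ s, lam (x * h) = f x)
    {z w : H ⊗[k] H}
    (hzw : ∀ h : H, lap (lam ∘ₗ LinearMap.mulRight k h) z = lap (lam ∘ₗ LinearMap.mulRight k h) w)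
    (f : H →ₗ[k] k) : lap f z = lap f w := by
  classical
  have key : ∀ t : H ⊗[k] H, ∃ s : Finset H, ∀ f g : H →ₗ[k] k, (∀ x ∈ s, f x = g x) →
      lap f t = lap g t := by
    intro t
    induction t with
    | zero => exact ⟨∅, by simp⟩
    | add t t' ht ht' =>
      obtain ⟨s, hs⟩ := ht
      obtain ⟨s', hs'⟩ := ht'
      refine ⟨s ∪ s', fun f g hfg => ?_⟩
      rw [map_add, map_add, hs f g fun x hx => hfg x (Finset.mem_union_left _ hx),
        hs' f g fun x hx => hfg x (Finset.mem_union_right _ hx)]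
    | tmul p q => exact ⟨{p}, fun f g hfg => by simp [hfg p (by simp)]⟩
  obtain ⟨s, hs⟩ := key z
  obtain ⟨s', hs'⟩ := key w
  obtain ⟨h, hh⟩ := hdense f (s ∪ s')
  rw [← hs (lam ∘ₗ LinearMap.mulRight k h) f fun x hx => hh x (Finset.mem_union_left _ hx),
    ← hs' (lam ∘ₗ LinearMap.mulRight k h) f fun x hx => hh x (Finset.mem_union_right _ hx)]
  exact hzw h

end Slices

section Integral

variable {T : H →ₗ[k] H} {lam : H →ₗ[k] k}

lemma rap_comul_of_integral (hlam : ∀ f : H →ₗ[k] k, conv f lam = f 1 • lam) (h : H) :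
    rap lam (comul (R := k) h) = lam h • 1 := by
  rw [← sub_eq_zero, ← Module.forall_dual_apply_eq_zero_iff k]
  intro f
  have key : ∀ z : H ⊗[k] H, f (rap lam z) = LinearMap.mul' k k (TensorProduct.map f lam z) := by
    intro z
    induction z with
    | zero => simp
    | add z w hz hw => simp only [map_add, hz, hw]
    | tmul p q => simp [mul_comm]
  have := LinearMap.congr_fun (hlam f) h
  simp only [conv, LinearMap.comp_apply, ← key, LinearMap.smul_apply, smul_eq_mul] at this
  simp [this, mul_comm]

lemma rap_comul_mul (hl : ∀ h : H, T (𝐒 h) = h) (hr : ∀ h : H, 𝐒 (T h) = h)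
    (hlam : ∀ f : H →ₗ[k] k, conv f lam = f 1 • lam) (h : H) {x : H}
    {ι : Type*} (ρ : Coalgebra.Repr k x ι) :
    rap lam (comul (R := k) h * (1 ⊗ₜ[k] x)) =
      ∑ i ∈ ρ.index, lam (h * ρ.right i) • T (ρ.left i) := by
  simp [← sum_comul_mul_tmul_one hl hr ρ, Finset.mul_sum, ← mul_assoc, ← Bialgebra.comul_mul,
    rap_mul_tmul_one, rap_comul_of_integral hlam]

lemma lap_mul_comul (hl : ∀ h : H, T (𝐒 h) = h) (hr : ∀ h : H, 𝐒 (T h) = h) {c : H}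
    (hc : ∀ h : H, lT lam h = lam h • c) (h : H) {x : H}
    {ι : Type*} (ρ : Coalgebra.Repr k x ι) :
    lap lam ((x ⊗ₜ[k] 1) * comul (R := k) h) =
      ∑ i ∈ ρ.index, lam (ρ.left i * h) • (T (ρ.right i) * c) := by
  have hc' : ∀ h : H, lap lam (comul (R := k) h) = lam h • c := hc
  simp [← sum_one_tmul_mul_comul hl hr ρ, Finset.sum_mul, mul_assoc, ← Bialgebra.comul_mul,
    lap_one_tmul_mul, hc']

/-- `α(R¹₂) S⁻¹(R¹₁) R² = R² S⁻¹(R¹) c`, where `c` is the modular grouplike element of the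
left integral. -/
lemma slice_comul_eq_of_integral (hl : ∀ h : H, T (𝐒 h) = h) (hr : ∀ h : H, 𝐒 (T h) = h)
    (hlam : ∀ f : H →ₗ[k] k, conv f lam = f 1 • lam) {c : H}
    (hc : ∀ h : H, lT lam h = lam h • c) (α : H →ₗ[k] k)
    (hα : ∀ h l : H, lam (l * h) = lam (chiMap T α h * l))
    (hdense : ∀ (f : H →ₗ[k] k) (s : Finset H), ∃ h : H, ∀ x ∈ s, lam (x * h) = f x)
    {R : H ⊗[k] H}
    (hR : ∀ h : H, TensorProduct.comm k H H (comul (R := k) h) * R = R * comul (R := k) h) :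
    LinearMap.mul' k H ((T ∘ₗ rap α ∘ₗ comul).rTensor H R) =
      LinearMap.mul' k H (TensorProduct.comm k H H (T.rTensor H R)) * c := by
  set L : H ⊗[k] H →ₗ[k] H ⊗[k] H :=
    TensorProduct.map (chiMap T α) (LinearMap.mul' k H) ∘ₗ
      (TensorProduct.leftComm k H H H).toLinearMap ∘ₗ
      (TensorProduct.assoc k H H H).toLinearMap ∘ₗ
      (T.rTensor H ∘ₗ comul).rTensor H with hL
  set M : H ⊗[k] H →ₗ[k] H ⊗[k] H :=
    (LinearMap.mulRight k c ∘ₗ LinearMap.mul' k H ∘ₗ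
        (TensorProduct.comm k H H).toLinearMap).lTensor H ∘ₗ
      (TensorProduct.assoc k H H H).toLinearMap ∘ₗ
      (T.lTensor H ∘ₗ comul).rTensor H with hM
  have hL_tmul : ∀ x y : H, L (x ⊗ₜ y) =
      ∑ i ∈ (ℛ k x).index, chiMap T α ((ℛ k x).right i) ⊗ₜ (T ((ℛ k x).left i) * y) := by
    intro x y
    simp only [hL, LinearMap.comp_apply, LinearMap.rTensor_tmul]
    rw [← (ℛ k x).eq]
    simp [TensorProduct.sum_tmul]
  have hM_tmul : ∀ x y : H, M (x ⊗ₜ y) =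
      ∑ i ∈ (ℛ k x).index, (ℛ k x).left i ⊗ₜ (y * T ((ℛ k x).right i) * c) := by
    intro x y
    simp only [hM, LinearMap.comp_apply, LinearMap.rTensor_tmul]
    rw [← (ℛ k x).eq]
    simp [TensorProduct.sum_tmul]
  have hLlam : ∀ (h : H) (z : H ⊗[k] H), lap (lam ∘ₗ LinearMap.mulRight k h) (L z) =
      lap lam (TensorProduct.comm k H H (comul (R := k) h) * z) := by
    intro h z
    induction z with
    | zero => simp
    | add z w hz hw => simp only [map_add, mul_add, hz, hw]
    | tmul x y =>
      rw [lap_comm_mul_tmul, rap_comul_mul hl hr hlam h (ℛ k x), hL_tmul]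
      simp [← hα, Finset.sum_mul]
  have hMlam : ∀ (h : H) (z : H ⊗[k] H), lap (lam ∘ₗ LinearMap.mulRight k h) (M z) =
      lap lam (z * comul (R := k) h) := by
    intro h z
    induction z with
    | zero => simp
    | add z w hz hw => simp only [map_add, add_mul, hz, hw]
    | tmul x y =>
      have hxy : x ⊗ₜ[k] y = (1 ⊗ₜ y) * (x ⊗ₜ 1) := by simp
      rw [hM_tmul, hxy, mul_assoc, lap_one_tmul_mul, lap_mul_comul hl hr hc h (ℛ k x)]
      simp [Finset.mul_sum, mul_assoc]
  have hT : ∀ x : H, counit (R := k) (T x) = counit x := fun x => by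
    rw [← counit_antipode, hr]
  have hchi : ∀ x : H, counit (R := k) (chiMap T α x) = α x := by
    intro x
    conv_rhs => rw [← sum_counit_smul (ℛ k x)]
    conv_lhs => simp only [chiMap, LinearMap.comp_apply]; rw [← (ℛ k x).eq]
    simp [hT, mul_comm]
  have hLc : ∀ z : H ⊗[k] H, lap counit (L z) =
      LinearMap.mul' k H ((T ∘ₗ rap α ∘ₗ comul).rTensor H z) := by
    intro z
    induction z with
    | zero => simp
    | add z w hz hw => simp only [map_add, hz, hw]
    | tmul x y =>
      rw [hL_tmul]
      conv_rhs => simp only [LinearMap.rTensor_tmul, LinearMap.comp_apply]; rw [← (ℛ k x).eq]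
      simp [hchi, Finset.sum_mul]
  have hMc : ∀ z : H ⊗[k] H, lap counit (M z) =
      LinearMap.mul' k H (TensorProduct.comm k H H (T.rTensor H z)) * c := by
    intro z
    induction z with
    | zero => simp
    | add z w hz hw => simp only [map_add, add_mul, hz, hw]
    | tmul x y =>
      rw [hM_tmul]
      have := sum_counit_smul (ℛ k x)
      conv_rhs => rw [← this]
      simp [Finset.sum_mul, Finset.mul_sum]
  rw [← hLc, ← hMc]
  exact lap_eq_of_forall_lap_mul hdense (fun h => by rw [hLlam, hMlam, hR]) counit

end Integral

section Quasitriangular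

variable {T : H →ₗ[k] H} {R U : H ⊗[k] H}

/-- `α(R¹₂) T(R¹₁) R² = T(R¹) R² · α(r¹) r²`. -/
lemma slice_comul_eq_mul_lap (T : H →ₗ[k] H) (α : H →ₗ[k] k)
    (hqt1 : (comul (R := k)).rTensor H R =
      ((Algebra.TensorProduct.includeLeft : H →ₐ[k] (H ⊗[k] H)).toLinearMap.rTensor H R) *
      ((Algebra.TensorProduct.includeRight : H →ₐ[k] (H ⊗[k] H)).toLinearMap.rTensor H R)) :
    LinearMap.mul' k H ((T ∘ₗ rap α ∘ₗ comul).rTensor H R) =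
      LinearMap.mul' k H (T.rTensor H R) * lap α R := by
  have key : ∀ z w : H ⊗[k] H, LinearMap.mul' k H ((T ∘ₗ rap α).rTensor H
      (((Algebra.TensorProduct.includeLeft : H →ₐ[k] (H ⊗[k] H)).toLinearMap.rTensor H z) *
      ((Algebra.TensorProduct.includeRight : H →ₐ[k] (H ⊗[k] H)).toLinearMap.rTensor H w))) =
      LinearMap.mul' k H (T.rTensor H z) * lap α w := by
    intro z w
    induction z with
    | zero => simp
    | add z z' hz hz' => simp only [map_add, add_mul, hz, hz']
    | tmul x y =>
      induction w with
      | zero => simp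
      | add w w' hw hw' => simp only [map_add, mul_add, hw, hw']
      | tmul p q => simp [mul_assoc]
  rw [← LinearMap.comp_assoc, LinearMap.rTensor_comp_apply, hqt1, key]

/-- `(S ⊗ id)(R) R = 1`. -/
lemma antipode_rTensor_mul_self
    (hqt1 : (comul (R := k)).rTensor H R =
      ((Algebra.TensorProduct.includeLeft : H →ₐ[k] (H ⊗[k] H)).toLinearMap.rTensor H R) *
      ((Algebra.TensorProduct.includeRight : H →ₐ[k] (H ⊗[k] H)).toLinearMap.rTensor H R))
    (hqt3l : lap (counit (R := k)) R = 1) :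
    (𝐒 : H →ₗ[k] H).rTensor H R * R = 1 := by
  have key : ∀ z w : H ⊗[k] H,
      (LinearMap.mul' k H ∘ₗ (𝐒 : H →ₗ[k] H).rTensor H).rTensor H
      (((Algebra.TensorProduct.includeLeft : H →ₐ[k] (H ⊗[k] H)).toLinearMap.rTensor H z) *
      ((Algebra.TensorProduct.includeRight : H →ₐ[k] (H ⊗[k] H)).toLinearMap.rTensor H w)) =
      (𝐒 : H →ₗ[k] H).rTensor H z * w := by
    intro z w
    induction z with
    | zero => simp
    | add z z' hz hz' => simp only [map_add, add_mul, hz, hz']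
    | tmul x y =>
      induction w with
      | zero => simp
      | add w w' hw hw' => simp only [map_add, mul_add, hw, hw']
      | tmul p q => simp
  have key' : ∀ z : H ⊗[k] H,
      (Algebra.linearMap k H ∘ₗ counit).rTensor H z = 1 ⊗ₜ lap counit z := by
    intro z
    induction z with
    | zero => simp
    | add z w hz hw => simp only [map_add, TensorProduct.tmul_add, hz, hw]
    | tmul x y => simp [Algebra.algebraMap_eq_smul_one, TensorProduct.smul_tmul]
  rw [← key, ← hqt1, ← LinearMap.rTensor_comp_apply, LinearMap.comp_assoc,
    mul_antipode_rTensor_comul, key', hqt3l, Algebra.TensorProduct.one_def]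

/-- `(id ⊗ S⁻¹)(R) R = 1`. -/
lemma inverse_antipode_lTensor_mul_self
    (hl : ∀ h : H, T (𝐒 h) = h) (hr : ∀ h : H, 𝐒 (T h) = h)
    (hqt2 : (comul (R := k)).lTensor H R =
      ((Algebra.TensorProduct.includeRight : H →ₐ[k] (H ⊗[k] H)).toLinearMap.lTensor H R) *
      ((Algebra.TensorProduct.includeLeft : H →ₐ[k] (H ⊗[k] H)).toLinearMap.lTensor H R))
    (hqt3r : rap (counit (R := k)) R = 1) :
    T.lTensor H R * R = 1 := by
  have key : ∀ z w : H ⊗[k] H,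
      (LinearMap.mul' k H ∘ₗ T.rTensor H ∘ₗ (TensorProduct.comm k H H).toLinearMap).lTensor H
      (((Algebra.TensorProduct.includeRight : H →ₐ[k] (H ⊗[k] H)).toLinearMap.lTensor H z) *
      ((Algebra.TensorProduct.includeLeft : H →ₐ[k] (H ⊗[k] H)).toLinearMap.lTensor H w)) =
      T.lTensor H z * w := by
    intro z w
    induction z with
    | zero => simp
    | add z z' hz hz' => simp only [map_add, add_mul, hz, hz']
    | tmul x y =>
      induction w with
      | zero => simp
      | add w w' hw hw' => simp only [map_add, mul_add, hw, hw']
      | tmul p q => simp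
  have key' : ∀ z : H ⊗[k] H,
      (Algebra.linearMap k H ∘ₗ counit).lTensor H z = rap counit z ⊗ₜ 1 := by
    intro z
    induction z with
    | zero => simp
    | add z w hz hw => simp only [map_add, TensorProduct.add_tmul, hz, hw]
    | tmul x y => simp [Algebra.algebraMap_eq_smul_one, TensorProduct.smul_tmul]
  have hcomp : (LinearMap.mul' k H ∘ₗ T.rTensor H ∘ₗ (TensorProduct.comm k H H).toLinearMap) ∘ₗ
      comul = Algebra.linearMap k H ∘ₗ counit := by
    ext y
    simpa using inverse_antipode_mul_comul hl hr y
  rw [← key, ← hqt2, ← LinearMap.lTensor_comp_apply, hcomp, key', hqt3r,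
    Algebra.TensorProduct.one_def]

lemma antipode_lTensor_eq_inverse_antipode_rTensor
    (hl : ∀ h : H, T (𝐒 h) = h) (hr : ∀ h : H, 𝐒 (T h) = h)
    (h : (𝐒 : H →ₗ[k] H).rTensor H R = T.lTensor H R) :
    (𝐒 : H →ₗ[k] H).lTensor H R = T.rTensor H R := by
  have h₁ : T ∘ₗ (𝐒 : H →ₗ[k] H) = LinearMap.id := LinearMap.ext hl
  have h₂ : (𝐒 : H →ₗ[k] H) ∘ₗ T = LinearMap.id := LinearMap.ext hr
  have := congrArg (TensorProduct.map T (𝐒 : H →ₗ[k] H)) h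
  rwa [← LinearMap.comp_apply, ← LinearMap.comp_apply, LinearMap.map_comp_rTensor,
    LinearMap.map_comp_lTensor, h₁, h₂] at this

lemma antipode_mul_inverse_antipode_rTensor (hr : ∀ h : H, 𝐒 (T h) = h) (z : H ⊗[k] H) :
    𝐒 (LinearMap.mul' k H (T.rTensor H z)) = uElt z := by
  induction z with
  | zero => simp [uElt]
  | add z w hz hw => simp only [uElt, map_add] at hz hw ⊢; rw [hz, hw]
  | tmul x y => simp [uElt, antipode_mul_antidistrib, hr]

end Quasitriangular

/-- $S(u) = u$ if and only if $a_α = a^{-1}$,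
i.e. iff $α(R^1)R^2 = a^{-1}$. -/
theorem antipode_u_eq_u_iff
    (lam : H →ₗ[k] k) (hlam_ne : lam ≠ 0)
    (hlam_int : ∀ f : H →ₗ[k] k, conv f lam = f 1 • lam)
    (a : H) (ha_ne : a ≠ 0) (ha_grp : Coalgebra.comul (R := k) a = a ⊗ₜ[k] a)
    (ha_mod : ∀ h : H, lT lam h = lam h • (𝐒 a))
    (ha_S2 : ∀ h : H, lam (𝐒 (𝐒 h)) = lam (a * h * 𝐒 a))
    (Sinv : H →ₗ[k] H) (hSinv_l : ∀ h : H, Sinv (𝐒 h) = h)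
    (hSinv_r : ∀ h : H, 𝐒 (Sinv h) = h)
    (α : H →ₐ[k] k)
    (hα : ∀ h l : H, lam (l * h) = lam ((chiMap Sinv α.toLinearMap h) * l))
    (R U : H ⊗[k] H) (hRU : R * U = 1) (hUR : U * R = 1)
    (hqt4 : ∀ h : H, (TensorProduct.comm k H H) (Coalgebra.comul (R := k) h) =
      R * (Coalgebra.comul (R := k) h) * U)
    (hqt1 : (Coalgebra.comul (R := k)).rTensor H R =
      (((Algebra.TensorProduct.includeLeft : H →ₐ[k] (H ⊗[k] H))).toLinearMap.rTensor H R) *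
      (((Algebra.TensorProduct.includeRight : H →ₐ[k] (H ⊗[k] H))).toLinearMap.rTensor H R))
    (hqt2 : (Coalgebra.comul (R := k)).lTensor H R =
      (LinearMap.lTensor H ((Algebra.TensorProduct.includeRight : H →ₐ[k] (H ⊗[k] H))).toLinearMap R) *
      (LinearMap.lTensor H ((Algebra.TensorProduct.includeLeft : H →ₐ[k] (H ⊗[k] H))).toLinearMap R))
    (hqt3l : lap (Coalgebra.counit (R := k)) R = 1)
    (hqt3r : rap (Coalgebra.counit (R := k)) R = 1)
    (u' : H) (hu_r : uElt R * u' = 1) (hu_l : u' * uElt R = 1)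
    (hS2u : ∀ h : H, 𝐒 (𝐒 h) = uElt R * h * u')
    (hΔu : Coalgebra.comul (R := k) (uElt R) =
      ((uElt R) ⊗ₜ[k] (uElt R)) * (U * ((TensorProduct.comm k H H) U)))
    (v : H) (hv_r : 𝐒 (uElt R) * v = 1) (hv_l : v * 𝐒 (uElt R) = 1)
    (hdense : ∀ (f : H →ₗ[k] k) (s : Finset H), ∃ h : H, ∀ x ∈ s, lam (x * h) = f x) :
    𝐒 (uElt R) = uElt R ↔ lap α.toLinearMap R = 𝐒 a := by
  have hR : ∀ h : H, TensorProduct.comm k H H (comul (R := k) h) * R = R * comul (R := k) h :=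
    fun h => by rw [hqt4, mul_assoc, hUR, mul_one]
  have hinv : (𝐒 : H →ₗ[k] H).rTensor H R = Sinv.lTensor H R :=
    (left_inv_eq_right_inv (antipode_rTensor_mul_self hqt1 hqt3l) hRU).trans
      (left_inv_eq_right_inv
        (inverse_antipode_lTensor_mul_self hSinv_l hSinv_r hqt2 hqt3r) hRU).symm
  have hu : uElt R = LinearMap.mul' k H (TensorProduct.comm k H H (Sinv.rTensor H R)) := by
    rw [uElt, antipode_lTensor_eq_inverse_antipode_rTensor hSinv_l hSinv_r hinv]
  have hp := antipode_mul_inverse_antipode_rTensor hSinv_r R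
  have hSu : 𝐒 (uElt R) = LinearMap.mul' k H (Sinv.rTensor H R) := by
    apply Function.LeftInverse.injective hSinv_l
    rw [hp, hS2u, mul_assoc, hu_r, mul_one]
  have hmain : 𝐒 (uElt R) * lap α.toLinearMap R = uElt R * 𝐒 a := by
    rw [hSu, ← slice_comul_eq_mul_lap Sinv α.toLinearMap hqt1, hu]
    exact slice_comul_eq_of_integral hSinv_l hSinv_r hlam_int ha_mod α.toLinearMap hα hdense hR
  have ha : 𝐒 a * a = 1 := by
    have h₁ : counit (R := k) a • a = a := by
      have := rTensor_counit_comul (R := k) a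
      rw [ha_grp, LinearMap.rTensor_tmul] at this
      simpa using congrArg (TensorProduct.lid k H) this
    have h₂ : counit (R := k) a = 1 := smul_left_injective k ha_ne (by simpa using h₁)
    simpa [ha_grp, h₂] using mul_antipode_rTensor_comul_apply (R := k) a
  constructor
  · intro h
    rw [h] at hmain
    simpa [← mul_assoc, hu_l] using congrArg (u' * ·) hmain
  · intro h
    rw [h] at hmain
    simpa [mul_assoc, ha] using congrArg (· * a) hmain
end
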